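/- arXiv:1610.06012 — 2 statements merged into one kernel-verified Lean document; each statement's English description precedes it below -/
import Mathlib

section
/- (Proposition 3.2, discrete form.) Let m ≥ 1 and let (S_n)_{n≥0} and (t_n)_{n≥0} be sequences with S_n ≥ 0 and t_n ≥ 0. Let (W^{c+m}_n) in ℝ^{c+m} and (W^c_n) in ℝ^c be defined recursively by W_{n+1} = step_{S_n, t_n}(W_n) from workload-vector initial conditions satisfying W^{c+m}_0 ⊴ W^c_0. Then W^{c+m}_n ⊴ W^c_n for all n ≥ 0; that is, a Kiefer–Wolfowitz workload process with c+m servers seeing the same arrival times and service durations as one with c servers remains ⊴-dominated by it for all time. -/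
open scoped Classical

noncomputable section

/-- The `k`-th coordinate (0-based) of a vector in `ℝ^n`, defaulting to 0 out of range. -/
def coord {n : ℕ} (V : Fin n → ℝ) (k : ℕ) : ℝ :=
  if h : k < n then V ⟨k, h⟩ else 0

/-- A workload vector: coordinates nonnegative and in increasing order. -/
def IsWorkload {n : ℕ} (V : Fin n → ℝ) : Prop :=
  Monotone V ∧ ∀ i, 0 ≤ V i

/-- Add the service duration `S` to the minimal (first) coordinate. -/
def bump {n : ℕ} (S : ℝ) (V : Fin n → ℝ) : Fin n → ℝ :=
  fun i => if (i : ℕ) = 0 then V i + S else V i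

/-- The arrival step: increasing rearrangement of the vector obtained from `V`
by replacing its minimal coordinate `V(1)` by `V(1) + S`. -/
def arr {n : ℕ} (S : ℝ) (V : Fin n → ℝ) : Fin n → ℝ :=
  bump S V ∘ Tuple.sort (bump S V)

/-- The decay step: each coordinate decreases by `t`, truncated at 0. -/
def dec {n : ℕ} (t : ℝ) (V : Fin n → ℝ) : Fin n → ℝ :=
  fun i => max (V i - t) 0

/-- The Kiefer-Wolfowitz one-step update with service `S` and elapsed time `t`. -/
def step {n : ℕ} (S t : ℝ) (V : Fin n → ℝ) : Fin n → ℝ :=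
  dec t (arr S V)

/-- `kU S V` (1-based): the least `k ∈ {1,…,n−1}` with `V(1)+S ≤ V(k+1)`
(0-based: `coord V 0 + S ≤ coord V k`), and `n` if there is no such `k`. -/
def kU {n : ℕ} (S : ℝ) (V : Fin n → ℝ) : ℕ :=
  sInf ({k : ℕ | 1 ≤ k ∧ k < n ∧ coord V 0 + S ≤ coord V k} ∪ {n})

/-- `OrdDom V W` (i.e. `V ⊴ W`): each of the `c` busiest servers of `V ∈ ℝ^{c+m}`
has no more work than the corresponding server of `W ∈ ℝ^c`. -/
def OrdDom {c m : ℕ} (V : Fin (c + m) → ℝ) (W : Fin c → ℝ) : Prop :=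
  ∀ k : ℕ, k < c → coord V (k + m) ≤ coord W k

/-- The time-to-coalescence `C(L,U)`: equal to `U(n)` for
`n = max{k : L(k) ≠ U(k)}` when `L ≠ U`, and `0` when `L = U`. -/
def coalTime {n : ℕ} (L U : Fin n → ℝ) : ℝ :=
  if L = U then 0 else coord U (sSup {k : ℕ | k < n ∧ coord L k ≠ coord U k})

end

/-- The `j`-th coordinate after an arrival is at most `a` if and only if fewer than `n - j`
entries of the bumped vector exceed `a`. -/
theorem arr_le_iff {n : ℕ} (S : ℝ) (V : Fin n → ℝ) (j : Fin n) (a : ℝ) :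
    arr S V j ≤ a ↔ (j : ℕ) + (Finset.univ.filter fun i => a < bump S V i).card < n := by
  have hcard : (Finset.univ.filter fun i => a < bump S V i).card =
      (Finset.univ.filter fun i => a < arr S V i).card := by
    refine (Finset.card_equiv (Tuple.sort (bump S V)) fun i => ?_).symm
    simp only [Finset.mem_filter, Finset.mem_univ, true_and]
    rfl
  have hmono : Monotone (arr S V) := Tuple.monotone_sort _
  rw [hcard]
  constructor
  · intro hj
    have hsub : (Finset.univ.filter fun i => a < arr S V i) ⊆ Finset.Ioi j := by
      intro i hi
      simp only [Finset.mem_filter, Finset.mem_univ, true_and, Finset.mem_Ioi] at hi ⊢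
      by_contra hij
      exact absurd (hmono (not_lt.mp hij)) (by linarith)
    have := Finset.card_le_card hsub
    rw [Fin.card_Ioi] at this
    have := j.isLt
    omega
  · intro hlt
    by_contra! hj
    have hsub : Finset.Ici j ⊆ (Finset.univ.filter fun i => a < arr S V i) := by
      intro i hi
      simp only [Finset.mem_filter, Finset.mem_univ, true_and, Finset.mem_Ici] at hi ⊢
      exact hj.trans_le (hmono hi)
    have := Finset.card_le_card hsub
    rw [Fin.card_Ici] at this
    omega

theorem coord_of_lt {n : ℕ} (V : Fin n → ℝ) {k : ℕ} (h : k < n) : coord V k = V ⟨k, h⟩ :=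
  dif_pos h

theorem le_bump {n : ℕ} {S : ℝ} (hS : 0 ≤ S) (V : Fin n → ℝ) (i : Fin n) :
    V i ≤ bump S V i := by
  unfold bump
  split_ifs <;> linarith

theorem IsWorkload.step {n : ℕ} (S t : ℝ) (V : Fin n → ℝ) : IsWorkload (step S t V) := by
  refine ⟨fun i j hij => ?_, fun i => le_max_right _ _⟩
  have : arr S V i ≤ arr S V j := Tuple.monotone_sort (bump S V) hij
  exact max_le_max_right 0 (sub_le_sub_right this t)

theorem OrdDom.arr {c m : ℕ} {S : ℝ} (hS : 0 ≤ S) {V : Fin (c + m) → ℝ} {W : Fin c → ℝ}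
    (hV : Monotone V) (hW : Monotone W) (h : OrdDom V W) : OrdDom (arr S V) (arr S W) := by
  intro k hk
  have hc : 0 < c := by omega
  have hdom : ∀ (i : ℕ) (hi : i < c), V ⟨i + m, by omega⟩ ≤ W ⟨i, hi⟩ := fun i hi => by
    simpa only [coord_of_lt _ hi, coord_of_lt V (show i + m < c + m by omega)] using h i hi
  rw [coord_of_lt _ hk, coord_of_lt _ (show k + m < c + m by omega), arr_le_iff]
  set a := _root_.arr S W ⟨k, hk⟩ with ha
  have hWa := (arr_le_iff S W ⟨k, hk⟩ a).mp le_rfl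
  have hW0 : W ⟨0, hc⟩ ≤ a :=
    (hW (Fin.mk_le_mk.mpr (Nat.zero_le _))).trans (le_bump hS W (Tuple.sort (bump S W) ⟨k, hk⟩))
  have hVm : ∀ i : Fin (c + m), (i : ℕ) ≤ m → V i ≤ a := fun i hi => by
    have h1 : V i ≤ V ⟨0 + m, by omega⟩ := hV (Fin.le_def.mpr (by simpa using hi))
    exact h1.trans ((hdom 0 hc).trans hW0)
  have hlow : ∀ i : Fin (c + m), a < bump S V i → (i : ℕ) = 0 ∨ m < i := fun i hi => by
    by_contra! hcon
    rw [bump, if_neg hcon.1] at hi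
    exact (hVm i hcon.2).not_gt hi
  have hcard : (Finset.univ.filter fun i => a < bump S V i).card ≤
      (Finset.univ.filter fun i => a < bump S W i).card := by
    refine Finset.card_le_card_of_injOn (fun i => ⟨i - m, by omega⟩) (fun i hi => ?_)
      fun i hi j hj hij => ?_
    · simp only [Finset.coe_filter, Finset.mem_univ, true_and, Set.mem_ofPred_eq] at hi ⊢
      rcases hlow i hi with h0 | h0
      · have h1 : V i ≤ V ⟨0 + m, by omega⟩ := hV (Fin.le_def.mpr (by simp [h0]))
        have h2 := hdom 0 hc
        simp only [bump, h0, if_true, Nat.zero_sub] at hi ⊢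
        linarith
      · have h1 := hdom (i - m) (by omega)
        have h2 : (⟨i - m + m, by omega⟩ : Fin (c + m)) = i := Fin.ext (Nat.sub_add_cancel h0.le)
        rw [h2] at h1
        rw [bump, if_neg (by omega)] at hi
        exact hi.trans_le (h1.trans (le_bump hS W _))
    · simp only [Finset.coe_filter, Finset.mem_univ, true_and, Set.mem_ofPred_eq] at hi hj
      have := hlow i hi
      have := hlow j hj
      have := congrArg Fin.val hij
      simp only at this
      exact Fin.ext (by omega)
  simp only at hWa ⊢
  omega

theorem OrdDom.dec {c m : ℕ} (t : ℝ) {V : Fin (c + m) → ℝ} {W : Fin c → ℝ}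
    (h : OrdDom V W) : OrdDom (dec t V) (dec t W) := by
  intro k hk
  have := h k hk
  rw [coord_of_lt _ hk, coord_of_lt _ (show k + m < c + m by omega)] at this ⊢
  exact max_le_max_right 0 (sub_le_sub_right this t)

/-- Proposition 3.2, discrete form: a Kiefer-Wolfowitz workload process
with `c+m` servers seeing the same arrival times and service durations as one with
`c` servers remains `⊴`-dominated by it for all time. -/
theorem stmt4 {c m : ℕ} (hc : 1 ≤ c) (hm : 1 ≤ m)
    (S t : ℕ → ℝ) (hS : ∀ n, 0 ≤ S n) (ht : ∀ n, 0 ≤ t n)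
    (W' : ℕ → Fin (c + m) → ℝ) (W : ℕ → Fin c → ℝ)
    (hW'0 : IsWorkload (W' 0)) (hW0 : IsWorkload (W 0))
    (hdom0 : OrdDom (W' 0) (W 0))
    (hW' : ∀ n, W' (n + 1) = step (S n) (t n) (W' n))
    (hW : ∀ n, W (n + 1) = step (S n) (t n) (W n)) :
    ∀ n, OrdDom (W' n) (W n) := by
  have hwork' : ∀ n, IsWorkload (W' n)
    | 0 => hW'0
    | n + 1 => hW' n ▸ IsWorkload.step _ _ _
  have hwork : ∀ n, IsWorkload (W n)
    | 0 => hW0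
    | n + 1 => hW n ▸ IsWorkload.step _ _ _
  intro n
  induction n with
  | zero => exact hdom0
  | succ n ih =>
    rw [hW', hW]
    exact (ih.arr (hS n) (hwork' n).1 (hwork n).1).dec (t n)
end

section
/- (Lemma 3.6, single arrival step.) Let m ≥ 1. Let L, U ∈ ℝ^c and L', U' ∈ ℝ^{c+m} be workload vectors with L(k) ≤ U(k) for all k ≤ c, L'(k) ≤ U'(k) for all k ≤ c+m, and U' ⊴ U. Suppose that: (i) if L(1) = U(1) then U(1) = 0; and (ii) C(L', U') ≤ C(L, U). Then for any service duration S > 0, after an arrival with service S in both systems, C(arr_S(L'), arr_S(U')) ≤ C(arr_S(L), arr_S(U)). -/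
open scoped Classical

/-- The number of coordinates of `V` exceeding the level `s`. -/
noncomputable def countAbove {n : ℕ} (V : Fin n → ℝ) (s : ℝ) : ℕ :=
  (Finset.univ.filter fun i => s < V i).card

lemma coord_eq {n : ℕ} (V : Fin n → ℝ) (i : Fin n) : coord V i = V i := by
  simp [coord]

lemma countAbove_mono {n : ℕ} {V W : Fin n → ℝ} (h : ∀ i, V i ≤ W i) (s : ℝ) :
    countAbove V s ≤ countAbove W s := by
  refine Finset.card_le_card fun i hi => ?_
  simp only [Finset.mem_filter, Finset.mem_univ, true_and] at hi ⊢
  exact hi.trans_le (h i)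

lemma countAbove_comp_perm {n : ℕ} (V : Fin n → ℝ) (σ : Equiv.Perm (Fin n)) (s : ℝ) :
    countAbove (V ∘ σ) s = countAbove V s :=
  Finset.card_equiv σ (by simp)

lemma countAbove_arr {n : ℕ} (S : ℝ) (V : Fin n → ℝ) (s : ℝ) :
    countAbove (arr S V) s = countAbove (bump S V) s :=
  countAbove_comp_perm _ _ s

lemma monotone_arr {n : ℕ} (S : ℝ) (V : Fin n → ℝ) : Monotone (arr S V) :=
  Tuple.monotone_sort _

/-- At levels above the minimal coordinate, an arrival increases the count by one exactly
below the new workload. -/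
lemma countAbove_bump {n : ℕ} (z : Fin n) (hz : (z : ℕ) = 0) (V : Fin n → ℝ) (S s : ℝ)
    (hs : V z ≤ s) :
    countAbove (bump S V) s = countAbove V s + if s < V z + S then 1 else 0 := by
  have key : ∀ i, i ≠ z → bump S V i = V i := fun i hi => by
    have : (i : ℕ) ≠ 0 := fun h => hi (Fin.ext (h.trans hz.symm))
    simp [bump, this]
  have hbz : bump S V z = V z + S := by simp [bump, hz]
  split_ifs with h
  · rw [countAbove, countAbove, ← Finset.card_insert_of_notMem (a := z) (by simpa using hs)]
    congr 1
    ext i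
    by_cases hi : i = z
    · subst hi; simp [hbz, h]
    · simp [key i hi, hi]
  · rw [countAbove, countAbove, add_zero]
    congr 1
    ext i
    by_cases hi : i = z
    · subst hi; simp [hbz, h, hs.not_gt]
    · simp [key i hi]

lemma countAbove_lt_of_lt {n : ℕ} {V W : Fin n → ℝ} (hV : Monotone V) (hW : Monotone W)
    {k : Fin n} {s : ℝ} (hVk : V k ≤ s) (hWk : s < W k) :
    countAbove V s < countAbove W s := by
  refine Finset.card_lt_card ((Finset.ssubset_iff_of_subset fun i hi => ?_).2 ⟨k, ?_, ?_⟩)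
  · simp only [Finset.mem_filter, Finset.mem_univ, true_and] at hi ⊢
    have hki : k ≤ i := by
      by_contra! h
      linarith [hV h.le]
    exact hWk.trans_le (hW hki)
  · simpa using hWk
  · simpa using hVk

lemma arr_le_arr {n : ℕ} {S : ℝ} {V W : Fin n → ℝ} (h : ∀ i, V i ≤ W i) (i : Fin n) :
    arr S V i ≤ arr S W i := by
  by_contra! hlt
  have hcount := countAbove_lt_of_lt (monotone_arr S W) (monotone_arr S V) le_rfl hlt
  rw [countAbove_arr, countAbove_arr] at hcount
  refine hcount.not_ge (countAbove_mono (fun j => ?_) _)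
  unfold bump
  split_ifs <;> linarith [h j]

lemma arr_nonneg {n : ℕ} {S : ℝ} (hS : 0 ≤ S) {V : Fin n → ℝ} (hV : ∀ i, 0 ≤ V i)
    (i : Fin n) : 0 ≤ arr S V i := by
  simp only [arr, Function.comp_apply, bump]
  split_ifs <;> linarith [hV (Tuple.sort (bump S V) i)]

lemma coalTime_eq {n : ℕ} {L U : Fin n → ℝ} (h : L ≠ U) :
    ∃ k, coalTime L U = U k ∧ L k ≠ U k ∧ ∀ j, k < j → L j = U j := by
  set A := {k : ℕ | k < n ∧ coord L k ≠ coord U k} with hA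
  have hbdd : BddAbove A := ⟨n, fun k hk => hk.1.le⟩
  obtain ⟨i, hi⟩ := Function.ne_iff.1 h
  have hne : A.Nonempty := ⟨i, i.2, by simpa [coord_eq] using hi⟩
  obtain ⟨hlt, hk⟩ := Nat.sSup_mem hne hbdd
  refine ⟨⟨sSup A, hlt⟩, ?_, ?_, fun j hj => ?_⟩
  · rw [coalTime, if_neg h, ← coord_eq U]
  · rwa [← coord_eq L, ← coord_eq U]
  · by_contra hjne
    have hjA : (j : ℕ) ∈ A := ⟨j.2, by simpa [coord_eq] using hjne⟩
    exact (le_csSup hbdd hjA).not_gt hj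

lemma coalTime_nonneg {n : ℕ} {L U : Fin n → ℝ} (hU : ∀ i, 0 ≤ U i) : 0 ≤ coalTime L U := by
  by_cases h : L = U
  · simp [coalTime, h]
  · obtain ⟨k, hk, -⟩ := coalTime_eq h
    exact hk ▸ hU k

/-- The time-to-coalescence of ordered monotone vectors is the least nonnegative level above
which both vectors have the same counts. -/
lemma coalTime_le_iff {n : ℕ} {L U : Fin n → ℝ} (hL : Monotone L) (hU : Monotone U)
    (hLU : ∀ i, L i ≤ U i) {t : ℝ} (ht : 0 ≤ t) :
    coalTime L U ≤ t ↔ ∀ s, t ≤ s → countAbove L s = countAbove U s := by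
  by_cases h : L = U
  · subst h
    simp [coalTime, ht]
  obtain ⟨k, hk, hne, heq⟩ := coalTime_eq h
  rw [hk]
  constructor
  · intro hkt s hs
    unfold countAbove
    congr 1
    ext i
    simp only [Finset.mem_filter, Finset.mem_univ, true_and]
    refine ⟨fun hi => hi.trans_le (hLU i), fun hi => ?_⟩
    have hki : k < i := by
      by_contra! hik
      linarith [hU hik]
    rwa [heq i hki]
  · intro hcount
    by_contra! hkt
    exact (countAbove_lt_of_lt hL hU (le_max_left (L k) t)
      (max_lt ((hLU k).lt_of_ne hne) hkt)).ne (hcount _ (le_max_right _ _))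

/-- Lemma 3.6, single arrival step: under the stated hypotheses,
a common arrival preserves the ordering of the times-to-coalescence of the two
pairs of sandwiching vectors. -/
theorem stmt8 {c m : ℕ} (hc : 1 ≤ c) (hm : 1 ≤ m)
    (L U : Fin c → ℝ) (L' U' : Fin (c + m) → ℝ)
    (hL : IsWorkload L) (hU : IsWorkload U)
    (hL' : IsWorkload L') (hU' : IsWorkload U')
    (hLU : ∀ k, L k ≤ U k) (hLU' : ∀ k, L' k ≤ U' k)
    (hdom : OrdDom U' U)
    (h1 : coord L 0 = coord U 0 → coord U 0 = 0)
    (h2 : coalTime L' U' ≤ coalTime L U)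
    (S : ℝ) (hS : 0 < S) :
    coalTime (arr S L') (arr S U') ≤ coalTime (arr S L) (arr S U) := by
  let z : Fin c := ⟨0, hc⟩
  let z' : Fin (c + m) := ⟨0, by omega⟩
  have h1 : L z = U z → U z = 0 := by simpa only [coord_eq] using
    (show coord L z = coord U z → coord U z = 0 from h1)
  have hz' : U' z' ≤ U z := by
    have hm0 := hdom 0 hc
    rw [coord, dif_pos (by omega), show coord U 0 = U z from coord_eq U z] at hm0
    exact (hU'.1 (Fin.mk_le_mk.2 (Nat.zero_le _))).trans hm0
  set D := coalTime (arr S L) (arr S U) with hD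
  have hD0 : 0 ≤ D := coalTime_nonneg (arr_nonneg hS.le hU.2)
  have harr := (coalTime_le_iff (monotone_arr S L) (monotone_arr S U) (arr_le_arr hLU) hD0).1 le_rfl
  have hcount : ∀ s, D ≤ s → U z ≤ s →
      (countAbove L s + if s < L z + S then 1 else 0) =
        countAbove U s + if s < U z + S then 1 else 0 := by
    intro s hDs hUs
    rw [← countAbove_bump z rfl L S s ((hLU z).trans hUs), ← countAbove_bump z rfl U S s hUs,
      ← countAbove_arr, ← countAbove_arr]
    exact harr s hDs
  suffices hsuff : U z ≤ D ∧ (∀ s, D ≤ s → (s < L z + S ↔ s < U z + S)) ∧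
      (∀ s, D ≤ s → (s < L' z' + S ↔ s < U' z' + S)) by
    obtain ⟨hUD, hiff, hiff'⟩ := hsuff
    have hLUD : coalTime L U ≤ D := (coalTime_le_iff hL.1 hU.1 hLU hD0).2 fun s hs => by
      have := hcount s hs (hUD.trans hs)
      simp only [hiff s hs] at this
      exact Nat.add_right_cancel this
    have hcount' := (coalTime_le_iff hL'.1 hU'.1 hLU' hD0).1 (h2.trans hLUD)
    refine (coalTime_le_iff (monotone_arr S L') (monotone_arr S U') (arr_le_arr hLU') hD0).2
      fun s hs => ?_
    have hUs : U' z' ≤ s := hz'.trans (hUD.trans hs)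
    rw [countAbove_arr, countAbove_arr, countAbove_bump z' rfl L' S s ((hLU' z').trans hUs),
      countAbove_bump z' rfl U' S s hUs, hcount' s hs]
    simp only [hiff' s hs]
  rcases (hLU z).eq_or_lt with heq | hlt
  · have hU0 := h1 heq
    have heq' : L' z' = U' z' := by linarith [hL'.2 z', hLU' z']
    exact ⟨hU0.trans_le hD0, fun s _ => by rw [heq], fun s _ => by rw [heq']⟩
  · have hUSD : U z + S ≤ D := by
      by_contra! hDlt
      have hmax : max D (max (U z) (L z + S)) < U z + S :=
        max_lt hDlt (max_lt (by linarith) (by linarith))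
      have hcmax := hcount _ (le_max_left D (max (U z) (L z + S)))
        ((le_max_left _ _).trans (le_max_right _ _))
      rw [if_pos hmax, if_neg ((le_max_right _ _).trans (le_max_right _ _)).not_gt] at hcmax
      have := countAbove_mono hLU (max D (max (U z) (L z + S)))
      omega
    refine ⟨by linarith, fun s hs => ?_, fun s hs => ?_⟩
    · constructor <;> intro <;> linarith
    · have := hLU' z'
      constructor <;> intro <;> linarith
end
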